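/- Let A be a finite totally ordered alphabet with |A| = n and σ : A → ℕ with σ(a) ≥ 2 for every a ∈ A. Then the σ-Chinese monoid Ch(A,σ) contains exactly 2^n idempotent elements; more precisely, for every subset B ⊆ A there is exactly one idempotent element of Ch(A,σ) that is the image of a word whose content is B, and every idempotent of Ch(A,σ) arises in this way. -/

import Mathlib

/-- The defining relations of the σ-Chinese monoid: `cba = cab = bca` (for `a < b < c`),
`aba = baa` and `bba = bab` (for `a < b`), together with `a^(σ a) = a` for every letter. -/
def chineseRel {A : Type*} [LinearOrder A] (σ : A → ℕ) (U V : FreeMonoid A) : Prop :=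
  (∃ a b c : A, a < b ∧ b < c ∧
    U = FreeMonoid.of c * FreeMonoid.of b * FreeMonoid.of a ∧
    V = FreeMonoid.of c * FreeMonoid.of a * FreeMonoid.of b) ∨
  (∃ a b c : A, a < b ∧ b < c ∧
    U = FreeMonoid.of c * FreeMonoid.of a * FreeMonoid.of b ∧
    V = FreeMonoid.of b * FreeMonoid.of c * FreeMonoid.of a) ∨
  (∃ a b : A, a < b ∧
    U = FreeMonoid.of a * FreeMonoid.of b * FreeMonoid.of a ∧
    V = FreeMonoid.of b * FreeMonoid.of a * FreeMonoid.of a) ∨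
  (∃ a b : A, a < b ∧
    U = FreeMonoid.of b * FreeMonoid.of b * FreeMonoid.of a ∧
    V = FreeMonoid.of b * FreeMonoid.of a * FreeMonoid.of b) ∨
  (∃ a : A, U = FreeMonoid.of a ^ σ a ∧ V = FreeMonoid.of a)

/-- The congruence on the free monoid defining the σ-Chinese monoid `Ch(A, σ)`. -/
def chineseCon {A : Type*} [LinearOrder A] (σ : A → ℕ) : Con (FreeMonoid A) :=
  conGen (chineseRel σ)

/-- A map `g` from a linearly ordered alphabet into a monoid satisfying the Chinese relations,
such that `g a ^ L` acts as a right identity on `g a` for every letter `a`. -/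
structure ChineseMap {A M : Type*} [LinearOrder A] [Monoid M] (g : A → M) (L : ℕ) : Prop where
  cba_cab : ∀ ⦃a b c : A⦄, a < b → b < c → g c * g b * g a = g c * g a * g b
  cab_bca : ∀ ⦃a b c : A⦄, a < b → b < c → g c * g a * g b = g b * g c * g a
  aba_baa : ∀ ⦃a b : A⦄, a < b → g a * g b * g a = g b * g a * g a
  bba_bab : ∀ ⦃a b : A⦄, a < b → g b * g b * g a = g b * g a * g b
  pow_mul_self : ∀ a : A, g a ^ L * g a = g a

lemma commute_prod_map {A M : Type*} [Monoid M] {g : A → M} {x : M} {v : List A}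
    (hx : ∀ y ∈ v, Commute x (g y)) : Commute x (v.map g).prod := by
  apply Commute.list_prod_right
  simpa using hx

namespace ChineseMap

variable {A M : Type*} [LinearOrder A] [Monoid M] {g : A → M} {L : ℕ}

lemma mul_mul_right_comm (h : ChineseMap g L) {a y c : A} (hay : a ≤ y) (hyc : y ≤ c) :
    g c * g y * g a = g c * g a * g y := by
  rcases hay.eq_or_lt with rfl | hay
  · rfl
  rcases hyc.eq_or_lt with rfl | hyc
  · exact h.bba_bab hay
  · exact h.cba_cab hay hyc

lemma commute_mul (h : ChineseMap g L) {a y c : A} (hay : a ≤ y) (hyc : y ≤ c) :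
    g c * g a * g y = g y * g c * g a := by
  rcases hay.eq_or_lt with rfl | hay
  · rcases hyc.eq_or_lt with rfl | hyc
    · rfl
    · exact (h.aba_baa hyc).symm
  rcases hyc.eq_or_lt with rfl | hyc
  · exact (h.bba_bab hay).symm
  · exact h.cab_bca hay hyc

lemma commute_corner (h : ChineseMap g L) {a y c : A} (hay : a ≤ y) (hyc : y ≤ c) :
    Commute (g c * g a) (g y) := by
  rw [Commute, SemiconjBy, h.commute_mul hay hyc, mul_assoc]

lemma commute_corner_pow (h : ChineseMap g L) {a y c : A} (hay : a ≤ y) (hyc : y ≤ c) :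
    Commute ((g c * g a) ^ L) (g y) :=
  (h.commute_corner hay hyc).pow_left L

lemma mul_mul_eq_max_min (h : ChineseMap g L) {x y c : A} (hx : x ≤ c) (hy : y ≤ c) :
    g c * g x * g y = g (max x y) * g c * g (min x y) := by
  rcases le_total x y with hxy | hxy
  · rw [max_eq_right hxy, min_eq_left hxy, h.commute_mul hxy hy]
  · rw [max_eq_left hxy, min_eq_right hxy, h.mul_mul_right_comm hxy hx, h.commute_mul hxy hx]

lemma corner_pow (h : ChineseMap g L) {a c : A} (hac : a ≤ c) (k : ℕ) :
    (g c * g a) ^ k = g c ^ k * g a ^ k := by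
  induction k with
  | zero => simp
  | succ k ih =>
    have hz : Commute (g a ^ k) (g c * g a) := ((h.commute_corner le_rfl hac).pow_right k).symm
    rw [pow_succ, ih, mul_assoc, hz.eq, pow_succ, pow_succ']
    simp only [mul_assoc]

lemma self_mul_pow (h : ChineseMap g L) (a : A) : g a * g a ^ L = g a := by
  rw [← pow_succ', pow_succ, h.pow_mul_self]

lemma corner_pow_mul_corner (h : ChineseMap g L) {a c : A} (hac : a ≤ c) :
    (g c * g a) ^ L * (g c * g a) = g c * g a := by
  have hz : Commute (g a ^ L) (g c * g a) := ((h.commute_corner le_rfl hac).pow_right L).symm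
  rw [h.corner_pow hac, mul_assoc, hz.eq, mul_assoc, h.self_mul_pow, ← mul_assoc,
    h.pow_mul_self]

lemma corner_pow_mul_left_pow (h : ChineseMap g L) (hL : L ≠ 0) {a c : A} (hac : a ≤ c) :
    (g c * g a) ^ L * g c ^ L = (g c * g a) ^ L := by
  have hz : Commute ((g c * g a) ^ L) (g c ^ L) :=
    (h.commute_corner_pow hac le_rfl).pow_right L
  obtain ⟨k, rfl⟩ := Nat.exists_eq_succ_of_ne_zero hL
  rw [hz.eq, pow_succ' (g c * g a) k, ← mul_assoc, ← mul_assoc, h.pow_mul_self]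

lemma corner_pow_mul_right_pow (h : ChineseMap g L) (hL : L ≠ 0) (a c : A) :
    (g c * g a) ^ L * g a ^ L = (g c * g a) ^ L := by
  obtain ⟨k, rfl⟩ := Nat.exists_eq_succ_of_ne_zero hL
  rw [pow_succ (g c * g a) k, mul_assoc, mul_assoc, h.self_mul_pow]

lemma isIdempotentElem_corner_pow (h : ChineseMap g L) (hL : L ≠ 0) {a c : A} (hac : a ≤ c) :
    IsIdempotentElem ((g c * g a) ^ L) := by
  have hf := h.corner_pow_mul_left_pow hL hac
  have hf' := h.corner_pow_mul_right_pow hL a c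
  rw [IsIdempotentElem]
  nth_rw 2 [h.corner_pow hac]
  rw [← mul_assoc, hf, hf']

lemma commute_corner_pow_mul_right (h : ChineseMap g L) (hL : L ≠ 0) {a y c : A}
    (hay : a ≤ y) (hyc : y ≤ c) : Commute ((g c * g a) ^ L * g a) (g y) := by
  have hf := h.corner_pow_mul_left_pow hL (hay.trans hyc)
  have hc := (h.commute_corner_pow hay hyc).eq
  obtain ⟨k, rfl⟩ := Nat.exists_eq_succ_of_ne_zero hL
  have key := h.mul_mul_right_comm hay hyc
  rw [Commute, SemiconjBy, ← mul_assoc, ← hc, ← hf, pow_succ (g c) k]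
  simp only [mul_assoc] at key ⊢
  rw [key]

lemma commute_corner_pow_mul_left (h : ChineseMap g L) (hL : L ≠ 0) {a y c : A}
    (hay : a ≤ y) (hyc : y ≤ c) : Commute ((g c * g a) ^ L * g c) (g y) := by
  have hf := h.corner_pow_mul_right_pow hL a c
  have hfy := (h.commute_corner_pow hay hyc).eq
  have hfa := ((h.commute_corner_pow le_rfl (hay.trans hyc)).pow_right L).eq
  have hfc := (h.commute_corner_pow (hay.trans hyc) le_rfl).eq
  have hff : g a ^ L * (g c * g a) ^ L = (g c * g a) ^ L := by rw [← hfa, hf]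
  have key : g c * g y * g a = g y * g c * g a := by
    rw [h.mul_mul_right_comm hay hyc, h.commute_mul hay hyc]
  have key' : g c * g y * g a ^ L = g y * g c * g a ^ L := by
    obtain ⟨k, rfl⟩ := Nat.exists_eq_succ_of_ne_zero hL
    rw [pow_succ', ← mul_assoc, key, mul_assoc]
  rw [Commute, SemiconjBy, hfc, mul_assoc, hfy, ← hff, ← mul_assoc, ← mul_assoc, key']
  simp only [mul_assoc]

/-- A word reaching from the largest letter to the smallest one absorbs the corner idempotent. -/
lemma corner_pow_mul_word (h : ChineseMap g L) {a c : A} (hac : a ≤ c) :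
    ∀ v : List A, (∀ y ∈ v, a ≤ y ∧ y ≤ c) →
      (g c * g a) ^ L * (g c * (v.map g).prod * g a) = g c * (v.map g).prod * g a
  | [], _ => by simpa using h.corner_pow_mul_corner hac
  | [y], hv => by
    obtain ⟨hay, hyc⟩ := hv y (by simp)
    have hfy := (h.commute_corner_pow hay hyc).eq
    simp only [List.map_cons, List.map_nil, List.prod_cons, List.prod_nil, mul_one]
    rw [h.mul_mul_right_comm hay hyc, h.commute_mul hay hyc, mul_assoc (g y), ← mul_assoc, hfy,
      mul_assoc, h.corner_pow_mul_corner hac]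
  | x :: y :: v, hv => by
    obtain ⟨hax, hxc⟩ := hv x (by simp)
    obtain ⟨hay, hyc⟩ := hv y (by simp)
    have ih := corner_pow_mul_word h hac (min x y :: v) (by
      intro t ht
      rcases List.mem_cons.1 ht with rfl | ht
      · exact ⟨le_min hax hay, (min_le_left _ _).trans hxc⟩
      · exact hv t (by simp [ht]))
    have hm := (h.commute_corner_pow (hax.trans (le_max_left x y)) (max_le hxc hyc)).eq
    have e : g c * ((x :: y :: v).map g).prod * g a
        = g (max x y) * (g c * ((min x y :: v).map g).prod * g a) := by
      have := h.mul_mul_eq_max_min hxc hyc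
      simp only [List.map_cons, List.prod_cons, ← mul_assoc]
      rw [this]
    rw [e, ← mul_assoc, hm, mul_assoc, ih]
  termination_by v => v.length

lemma corner_pow_mul_pow (h : ChineseMap g L) (hL : 2 ≤ L) {a c : A} {v : List A}
    (hv : ∀ y ∈ v, a ≤ y ∧ y ≤ c) (ha : a ∈ v) (hc : c ∈ v) :
    (g c * g a) ^ L * (v.map g).prod ^ L = (v.map g).prod ^ L := by
  have hac : a ≤ c := (hv c hc).1
  obtain ⟨k, rfl⟩ := Nat.exists_eq_add_of_le hL
  suffices hs : (g c * g a) ^ (2 + k) * ((v.map g).prod * (v.map g).prod)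
      = (v.map g).prod * (v.map g).prod by
    rw [pow_add (v.map g).prod, pow_two, ← mul_assoc, hs]
  obtain ⟨s, t, hst⟩ := List.append_of_mem hc
  obtain ⟨s', t', hst'⟩ := List.append_of_mem ha
  have hs : Commute ((g c * g a) ^ (2 + k)) (s.map g).prod := commute_prod_map fun y hy =>
    have := hv y (by simp [hst, hy])
    h.commute_corner_pow this.1 this.2
  have key := h.corner_pow_mul_word hac (t ++ s') (by
    intro y hy
    rcases List.mem_append.1 hy with hy | hy
    · exact hv y (by simp [hst, hy])
    · exact hv y (by simp [hst', hy]))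
  have e : (v.map g).prod * (v.map g).prod
      = (s.map g).prod * ((g c * ((t ++ s').map g).prod * g a) * (t'.map g).prod) := by
    nth_rw 1 [hst]
    rw [hst']
    simp [mul_assoc]
  rw [e, ← mul_assoc, hs.eq, mul_assoc, ← mul_assoc _ _ (t'.map g).prod, key]

lemma exists_corner_factor (h : ChineseMap g L) (hL : L ≠ 0) {a c : A} (hac : a ≤ c) (v : List A)
    (hv : ∀ y ∈ v, a ≤ y ∧ y ≤ c) :
    ∃ s : M, (∀ y, a ≤ y → y ≤ c → Commute s (g y)) ∧ s ^ L = (g c * g a) ^ L ∧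
      (g c * g a) ^ L * (v.map g).prod
        = s * ((v.filter fun y => y ≠ a ∧ y ≠ c).map g).prod := by
  have hidem := h.isIdempotentElem_corner_pow hL hac
  induction v with
  | nil =>
    exact ⟨(g c * g a) ^ L, fun y h₁ h₂ => h.commute_corner_pow h₁ h₂,
      hidem.pow_eq hL, by simp⟩
  | cons y v ih =>
    obtain ⟨s, hs, hsL, hsv⟩ := ih fun t ht => hv t (by simp [ht])
    obtain ⟨hay, hyc⟩ := hv y (by simp)
    have hfy := h.commute_corner_pow hay hyc
    have hfg : (g c * g a) ^ L * g y * (g c * g a) ^ L = (g c * g a) ^ L * g y := by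
      rw [mul_assoc, ← hfy.eq, ← mul_assoc, hidem.eq]
    have step (hz : ∀ t, a ≤ t → t ≤ c → Commute ((g c * g a) ^ L * g y) (g t))
        (hzL : (g c * g a) ^ L * g y ^ L = (g c * g a) ^ L) (hy : y = a ∨ y = c) :
        ∃ s : M, (∀ y, a ≤ y → y ≤ c → Commute s (g y)) ∧ s ^ L = (g c * g a) ^ L ∧
        (g c * g a) ^ L * ((y :: v).map g).prod
          = s * (((y :: v).filter fun y => y ≠ a ∧ y ≠ c).map g).prod := by
      refine ⟨(g c * g a) ^ L * g y * s, fun t h₁ h₂ => (hz t h₁ h₂).mul_left (hs t h₁ h₂), ?_, ?_⟩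
      · have hsf : Commute ((g c * g a) ^ L * g y) s :=
          (((hs c hac le_rfl).mul_right (hs a le_rfl hac)).pow_right L |>.mul_right
            (hs y hay hyc)).symm
        rw [hsf.mul_pow, hfy.mul_pow, hsL, hidem.pow_eq hL, hzL, hidem.eq]
      · rw [List.filter_cons_of_neg (by rcases hy with rfl | rfl <;> simp), mul_assoc _ s, ← hsv,
          List.map_cons, List.prod_cons, ← mul_assoc, ← mul_assoc, hfg]
    by_cases hya : y = a
    · subst hya
      exact step (fun t h₁ h₂ => h.commute_corner_pow_mul_right hL h₁ h₂)
        (h.corner_pow_mul_right_pow hL y c) (Or.inl rfl)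
    by_cases hyc' : y = c
    · subst hyc'
      exact step (fun t h₁ h₂ => h.commute_corner_pow_mul_left hL h₁ h₂)
        (h.corner_pow_mul_left_pow hL hac) (Or.inr rfl)
    refine ⟨s, hs, hsL, ?_⟩
    rw [List.filter_cons_of_pos (by simp [hya, hyc']), List.map_cons, List.prod_cons,
      List.map_cons, List.prod_cons, ← mul_assoc, hfy.eq, mul_assoc, hsv, ← mul_assoc,
      ← (hs y hay hyc).eq, mul_assoc]

lemma prod_pow_eq (h : ChineseMap g L) (hL : 2 ≤ L) {a c : A} {v : List A}
    (hv : ∀ y ∈ v, a ≤ y ∧ y ≤ c) (ha : a ∈ v) (hc : c ∈ v) :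
    (v.map g).prod ^ L = (g c * g a) ^ L *
      ((v.filter fun y => y ≠ a ∧ y ≠ c).map g).prod ^ L := by
  have hac : a ≤ c := (hv c hc).1
  have hL' : L ≠ 0 := by omega
  obtain ⟨s, hs, hsL, hsv⟩ := h.exists_corner_factor hL' hac v hv
  have hf : Commute ((g c * g a) ^ L) (v.map g).prod := commute_prod_map fun y hy =>
    h.commute_corner_pow (hv y hy).1 (hv y hy).2
  have hs' : Commute s ((v.filter fun y => y ≠ a ∧ y ≠ c).map g).prod := commute_prod_map fun y hy =>
    have := hv y (List.mem_of_mem_filter hy)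
    hs y this.1 this.2
  rw [← h.corner_pow_mul_pow hL hv ha hc]
  nth_rw 1 [← (h.isIdempotentElem_corner_pow hL' hac).pow_eq hL']
  rw [← hf.mul_pow, hsv, hs'.mul_pow, hsL]

/-- The `L`-th power of the image of a word depends only on the content of the word. -/
theorem prod_pow_eq_of_toFinset_eq (h : ChineseMap g L) (hL : 2 ≤ L) (v w : List A)
    (hvw : v.toFinset = w.toFinset) : (v.map g).prod ^ L = (w.map g).prod ^ L := by
  induction hn : v.toFinset.card using Nat.strong_induction_on generalizing v w with
  | _ n ih =>
    rcases v.toFinset.eq_empty_or_nonempty with h0 | hne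
    · rw [h0] at hvw
      rw [List.toFinset_eq_empty_iff] at h0
      rw [eq_comm, List.toFinset_eq_empty_iff] at hvw
      rw [h0, hvw]
    · set a := v.toFinset.min' hne with ha
      set c := v.toFinset.max' hne with hc
      have hav : a ∈ v.toFinset := Finset.min'_mem _ _
      have hcv : c ∈ v.toFinset := Finset.max'_mem _ _
      have hv : ∀ y ∈ v.toFinset, a ≤ y ∧ y ≤ c := fun y hy =>
        ⟨Finset.min'_le _ _ hy, Finset.le_max' _ _ hy⟩
      rw [h.prod_pow_eq hL (fun y hy => hv y (List.mem_toFinset.2 hy)) (List.mem_toFinset.1 hav)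
        (List.mem_toFinset.1 hcv),
        h.prod_pow_eq hL (fun y hy => hv y (hvw ▸ List.mem_toFinset.2 hy))
        (List.mem_toFinset.1 (hvw ▸ hav)) (List.mem_toFinset.1 (hvw ▸ hcv))]
      congr 1
      refine ih _ ?_ _ _ ?_ rfl
      · rw [← hn]
        refine Finset.card_lt_card (Finset.ssubset_iff_of_subset ?_ |>.2 ⟨a, hav, by simp⟩)
        intro y hy
        rw [List.mem_toFinset] at hy ⊢
        exact List.mem_of_mem_filter hy
      · rw [List.toFinset_filter, List.toFinset_filter, hvw]

end ChineseMap

section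

variable {A : Type*} [LinearOrder A]

lemma toFinset_toList_of_pow (a : A) {k : ℕ} (hk : k ≠ 0) :
    (FreeMonoid.of a ^ k).toList.toFinset = {a} := by
  induction k with
  | zero => exact absurd rfl hk
  | succ k ih =>
    rw [pow_succ, FreeMonoid.toList_mul, List.toFinset_append, FreeMonoid.toList_of]
    rcases eq_or_ne k 0 with rfl | hk
    · simp
    · simp [ih hk]

lemma toFinset_toList_pow (W : FreeMonoid A) {k : ℕ} (hk : k ≠ 0) :
    (W ^ k).toList.toFinset = W.toList.toFinset := by
  induction k with
  | zero => exact absurd rfl hk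
  | succ k ih =>
    rw [pow_succ, FreeMonoid.toList_mul, List.toFinset_append]
    rcases eq_or_ne k 0 with rfl | hk
    · simp
    · simp [ih hk]

/-- The congruence identifying words with equal content. -/
def contentCon (A : Type*) [LinearOrder A] : Con (FreeMonoid A) where
  r U V := U.toList.toFinset = V.toList.toFinset
  iseqv := ⟨fun _ => rfl, fun h => h.symm, fun h h' => h.trans h'⟩
  mul' h h' := by
    simp only [FreeMonoid.toList_mul, List.toFinset_append] at *
    rw [h, h']

lemma chineseCon_le_contentCon {σ : A → ℕ} (hσ : ∀ a, σ a ≠ 0) :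
    chineseCon σ ≤ contentCon A := by
  refine Con.conGen_le.2 ?_
  intro U V hUV
  change U.toList.toFinset = V.toList.toFinset
  rcases hUV with ⟨a, b, c, -, -, rfl, rfl⟩ | ⟨a, b, c, -, -, rfl, rfl⟩ | ⟨a, b, -, rfl, rfl⟩ |
    ⟨a, b, -, rfl, rfl⟩ | ⟨a, rfl, rfl⟩
  iterate 4
    ext x
    simp only [FreeMonoid.toList_mul, FreeMonoid.toList_of, List.mem_toFinset, List.mem_append,
      List.mem_singleton]
    tauto
  · rw [toFinset_toList_of_pow a (hσ a)]
    simp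

lemma chineseMap_mk' [Fintype A] {σ : A → ℕ} (hσ : ∀ a, 2 ≤ σ a) :
    ChineseMap (fun a => (chineseCon σ).mk' (FreeMonoid.of a)) (2 * ∏ a, (σ a - 1)) := by
  have rel {U V : FreeMonoid A} (hUV : chineseRel σ U V) :
      (chineseCon σ).mk' U = (chineseCon σ).mk' V :=
    (Con.eq _).2 (ConGen.Rel.of _ _ hUV)
  refine ⟨?_, ?_, ?_, ?_, ?_⟩
  · intro a b c hab hbc
    simp only [← map_mul]
    exact rel (Or.inl ⟨a, b, c, hab, hbc, rfl, rfl⟩)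
  · intro a b c hab hbc
    simp only [← map_mul]
    exact rel (Or.inr (Or.inl ⟨a, b, c, hab, hbc, rfl, rfl⟩))
  · intro a b hab
    simp only [← map_mul]
    exact rel (Or.inr (Or.inr (Or.inl ⟨a, b, hab, rfl, rfl⟩)))
  · intro a b hab
    simp only [← map_mul]
    exact rel (Or.inr (Or.inr (Or.inr (Or.inl ⟨a, b, hab, rfl, rfl⟩))))
  · intro a
    obtain ⟨m, hm⟩ : σ a - 1 ∣ 2 * ∏ a, (σ a - 1) :=
      (Finset.dvd_prod_of_mem (fun a => σ a - 1) (Finset.mem_univ a)).mul_left 2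
    have ha : (chineseCon σ).mk' (FreeMonoid.of a) ^ (σ a - 1) *
        (chineseCon σ).mk' (FreeMonoid.of a) = (chineseCon σ).mk' (FreeMonoid.of a) := by
      rw [← pow_succ, Nat.sub_add_cancel (one_le_two.trans (hσ a)), ← map_pow]
      exact rel (Or.inr (Or.inr (Or.inr (Or.inr ⟨a, rfl, rfl⟩))))
    rw [hm, pow_mul]
    clear hm
    induction m with
    | zero => simp
    | succ m ih => rw [pow_succ, mul_assoc, ha, ih]

end

lemma mk'_eq_prod {A : Type*} (c : Con (FreeMonoid A)) (W : FreeMonoid A) :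
    c.mk' W = (W.toList.map fun a => c.mk' (FreeMonoid.of a)).prod := by
  induction W using FreeMonoid.inductionOn' with
  | one => simp
  | of_mul a W ih => rw [map_mul, ih]; simp

/-- The σ-Chinese monoid `Ch(A, σ)` has exactly `2^|A|` idempotents: for every
subset `B ⊆ A` there is exactly one idempotent which is the image of a word with
content `B`, and (since every element is the image of a word, and all words
representing a given element have the same content) every idempotent arises this
way; moreover the number of idempotents is `2^|A|`. -/
theorem idempotents_chinese {A : Type*} [LinearOrder A] [Fintype A]
    (σ : A → ℕ) (hσ : ∀ a : A, 2 ≤ σ a) :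
    (∀ B : Finset A, ∃! x : (chineseCon σ).Quotient,
      x * x = x ∧ ∃ W : FreeMonoid A, W.toList.toFinset = B ∧ (chineseCon σ).mk' W = x) ∧
    Nat.card {x : (chineseCon σ).Quotient // x * x = x} = 2 ^ Fintype.card A := by
  set L := 2 * ∏ a, (σ a - 1)
  have hL : 2 ≤ L := by
    have : 0 < ∏ a, (σ a - 1) := Finset.prod_pos fun a _ => by have := hσ a; omega
    omega
  have hL0 : L ≠ 0 := by omega
  have key (U V : FreeMonoid A) (hUV : U.toList.toFinset = V.toList.toFinset) :
      (chineseCon σ).mk' U ^ L = (chineseCon σ).mk' V ^ L := by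
    rw [mk'_eq_prod _ U, mk'_eq_prod _ V]
    exact (chineseMap_mk' hσ).prod_pow_eq_of_toFinset_eq hL _ _ hUV
  have main : ∀ B : Finset A, ∃! x : (chineseCon σ).Quotient,
      x * x = x ∧ ∃ W : FreeMonoid A, W.toList.toFinset = B ∧ (chineseCon σ).mk' W = x := by
    intro B
    let W : FreeMonoid A := FreeMonoid.ofList B.toList
    have hW : W.toList.toFinset = B := Finset.toList_toFinset B
    refine ⟨(chineseCon σ).mk' W ^ L, ⟨?_, W ^ L, ?_, map_pow _ _ _⟩, ?_⟩
    · have hWW := key (W ^ 2) W (toFinset_toList_pow W two_ne_zero)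
      rwa [map_pow, ← pow_mul, mul_comm, pow_mul, pow_two] at hWW
    · rw [toFinset_toList_pow W hL0, hW]
    · rintro y ⟨hy, V, hV, rfl⟩
      rw [← key V W (hV.trans hW.symm)]
      exact (IsIdempotentElem.pow_eq hy hL0).symm
  refine ⟨main, ?_⟩
  choose F hF hFuniq using main
  have hbij : Function.Bijective
      (fun B : Finset A => (⟨F B, (hF B).1⟩ : {x : (chineseCon σ).Quotient // x * x = x})) := by
    constructor
    · intro B C hBC
      obtain ⟨U, rfl, hU⟩ := (hF B).2
      obtain ⟨V, rfl, hV⟩ := (hF C).2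
      have hUV : (chineseCon σ).mk' U = (chineseCon σ).mk' V := by
        rw [hU, hV]
        exact congrArg Subtype.val hBC
      exact chineseCon_le_contentCon (fun a => by have := hσ a; omega) ((Con.eq _).1 hUV)
    · rintro ⟨x, hx⟩
      obtain ⟨W, rfl⟩ := Con.mk'_surjective x
      exact ⟨W.toList.toFinset, Subtype.ext (hFuniq _ _ ⟨hx, W, rfl, rfl⟩).symm⟩
  rw [← Nat.card_eq_of_bijective _ hbij, Nat.card_eq_fintype_card, Fintype.card_finset]
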